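/- (Mode-reduced energy boundedness estimate, eq. (7).) There exists a constant C̃ > 0, depending only on M, C and s, such that for every integer ℓ ≥ s, every ε with 0 ≤ ε ≤ 1, every pair β^t, β^r satisfying the stated bounds with constant C, and every solution ψ of P_{s,ℓ}ψ = ε(β^t ∂_t ψ + β^r ∂_r ψ) (smooth up to r = 2M, with compact support in r on every compact time interval), one has for all τ > 0: Ē[ψ](τ) ≤ C̃ ( Ē[ψ](0) + ε · Ī_ndeg[ψ](0,τ) ). -/

import Mathlib

open MeasureTheory Set
open scoped ENNReal

noncomputable section

/-- `D(r) = 1 - 2M/r`. -/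
def Dc (M r : ℝ) : ℝ := 1 - 2*M/r

/-- `f(r) = (1 - 3M/r) √(1 + 6M/r)`. -/
def fc (M r : ℝ) : ℝ := (1 - 3*M/r) * Real.sqrt (1 + 6*M/r)

/-- Partial derivative in `t`. -/
def pt (ψ : ℝ → ℝ → ℝ) : ℝ → ℝ → ℝ := fun t r => deriv (fun t' => ψ t' r) t

/-- Partial derivative in `r`. -/
def pr (ψ : ℝ → ℝ → ℝ) : ℝ → ℝ → ℝ := fun t r => deriv (fun r' => ψ t r') r

/-- `R* = (2M/r) ∂_t + D ∂_r`. -/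
def Rst (M : ℝ) (ψ : ℝ → ℝ → ℝ) : ℝ → ℝ → ℝ :=
  fun t r => (2*M/r) * pt ψ t r + Dc M r * pr ψ t r

/-- `W = (r/√D)(R* + f T)`. -/
def Wc (M : ℝ) (ψ : ℝ → ℝ → ℝ) : ℝ → ℝ → ℝ :=
  fun t r => (r / Real.sqrt (Dc M r)) * (Rst M ψ t r + fc M r * pt ψ t r)

/-- The mode-reduced Regge--Wheeler operator `P_{s,ℓ}`. -/
def Pc (M : ℝ) (s ℓ : ℕ) (ψ : ℝ → ℝ → ℝ) : ℝ → ℝ → ℝ := fun t r =>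
  (1 + 2*M/r) * pt (pt ψ) t r - (4*M/r) * pt (pr ψ) t r + (2*M/r^2) * pt ψ t r
    - pr (fun t' r' => Dc M r' * pr ψ t' r') t r
    + ((ℓ : ℝ)*((ℓ : ℝ)+1)/r^2) * ψ t r + (1 - (s : ℝ)^2) * (2*M/r^3) * ψ t r

/-- Slice energy `E[ψ](τ)` (degenerate at the horizon). -/
def eE (M : ℝ) (ℓ : ℕ) (ψ : ℝ → ℝ → ℝ) (τ : ℝ) : ℝ≥0∞ :=
  ∫⁻ r in Ioi (2*M), ENNReal.ofReal
    ((pt ψ τ r)^2 + Dc M r * (pr ψ τ r)^2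
      + (ℓ : ℝ)*((ℓ : ℝ)+1)*(ψ τ r)^2/r^2 + (ψ τ r)^2/r^2)

/-- Non-degenerate slice energy `Ē[ψ](τ)`. -/
def eEbar (M : ℝ) (ℓ : ℕ) (ψ : ℝ → ℝ → ℝ) (τ : ℝ) : ℝ≥0∞ :=
  ∫⁻ r in Ioi (2*M), ENNReal.ofReal
    ((pt ψ τ r)^2 + (pr ψ τ r)^2
      + (ℓ : ℝ)*((ℓ : ℝ)+1)*(ψ τ r)^2/r^2 + (ψ τ r)^2/r^2)

/-- Spacetime energy `I_ndeg[ψ](τ₁,τ₂)` (degenerate at the horizon). -/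
def iNdeg (M : ℝ) (ℓ : ℕ) (ψ : ℝ → ℝ → ℝ) (τ₁ τ₂ : ℝ) : ℝ≥0∞ :=
  ∫⁻ τ in Ioc τ₁ τ₂, ∫⁻ r in Ioi (2*M), ENNReal.ofReal
    ((pt ψ τ r)^2/r^2 + Dc M r * (pr ψ τ r)^2/r^2
      + (ℓ : ℝ)*((ℓ : ℝ)+1)*(ψ τ r)^2/r^3 + (ψ τ r)^2/r^3)

/-- Non-degenerate spacetime energy `Ī_ndeg[ψ](τ₁,τ₂)`. -/
def iNdegBar (M : ℝ) (ℓ : ℕ) (ψ : ℝ → ℝ → ℝ) (τ₁ τ₂ : ℝ) : ℝ≥0∞ :=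
  ∫⁻ τ in Ioc τ₁ τ₂, ∫⁻ r in Ioi (2*M), ENNReal.ofReal
    ((pt ψ τ r)^2/r^2 + (pr ψ τ r)^2/r^2
      + (ℓ : ℝ)*((ℓ : ℝ)+1)*(ψ τ r)^2/r^3 + (ψ τ r)^2/r^3)

/-- Spacetime energy `Ī_deg[ψ](τ₁,τ₂)` degenerating at the photon sphere `r = 3M`. -/
def iDegBar (M : ℝ) (ℓ : ℕ) (ψ : ℝ → ℝ → ℝ) (τ₁ τ₂ : ℝ) : ℝ≥0∞ :=
  ∫⁻ τ in Ioc τ₁ τ₂, ∫⁻ r in Ioi (2*M), ENNReal.ofReal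
    ((1 - 3*M/r)^2 * ((pt ψ τ r)^2/r^2 + (pr ψ τ r)^2/r^2
        + (ℓ : ℝ)*((ℓ : ℝ)+1)*(ψ τ r)^2/r^3)
      + (Rst M ψ τ r)^2/r^2 + (ψ τ r)^2/r^3)

/-- Smoothness of a two-variable function on `ℝ × S`. -/
def SmoothOnRegion (ψ : ℝ → ℝ → ℝ) (S : Set ℝ) : Prop :=
  ContDiffOn ℝ (⊤ : ℕ∞) (Function.uncurry ψ) (univ ×ˢ S)

/-- Compact support in `r` on every compact time interval. -/
def CompactRSupport (ψ : ℝ → ℝ → ℝ) : Prop :=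
  ∀ a b : ℝ, ∃ R : ℝ, ∀ t r : ℝ, t ∈ Icc a b → R ≤ r → ψ t r = 0

/-- The pointwise bounds (5) on the perturbation `β = (β^t, β^r)`. -/
def BetaBounds (M C : ℝ) (βt βr : ℝ → ℝ → ℝ) : Prop :=
  ∀ t r : ℝ, 2*M < r →
    r^2 * |βt t r| + r^2 * |βr t r|
      + r ^ ((3:ℝ)/2) * |Wc M βt t r| + r ^ ((3:ℝ)/2) * |Wc M βr t r| ≤ C

/-- `ψ` solves the mode-reduced perturbed Regge--Wheeler equation. -/
def SolvesPerturbedRW (M : ℝ) (s ℓ : ℕ) (ε : ℝ) (βt βr ψ : ℝ → ℝ → ℝ) : Prop :=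
  ∀ t r : ℝ, 2*M < r →
    Pc M s ℓ ψ t r = ε * (βt t r * pt ψ t r + βr t r * pr ψ t r)

/-- The closed half-plane `ℝ × [x₀, ∞)`. -/
def halfPlane (x₀ : ℝ) : Set (ℝ × ℝ) := univ ×ˢ Ici x₀

theorem mk_mem_halfPlane {x₀ r : ℝ} (t : ℝ) (h : x₀ ≤ r) : (t, r) ∈ halfPlane x₀ :=
  ⟨mem_univ _, h⟩

theorem halfPlane_mem_nhds {x₀ t r : ℝ} (h : x₀ < r) : halfPlane x₀ ∈ nhds (t, r) :=
  prod_mem_nhds Filter.univ_mem (Ici_mem_nhds h)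

theorem uniqueDiffOn_halfPlane (x₀ : ℝ) : UniqueDiffOn ℝ (halfPlane x₀) :=
  uniqueDiffOn_univ.prod (uniqueDiffOn_Ici x₀)

theorem ContinuousOn.continuous_clamp {x₀ : ℝ} {h : ℝ × ℝ → ℝ}
    (hh : ContinuousOn h (halfPlane x₀)) : Continuous fun p : ℝ × ℝ => h (p.1, max x₀ p.2) :=
  hh.comp_continuous (by fun_prop) fun _ => mk_mem_halfPlane _ (le_max_left _ _)

theorem integral_clamp {x₀ R : ℝ} (hR : x₀ ≤ R) (h : ℝ × ℝ → ℝ) (t : ℝ) :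
    ∫ r in x₀..R, h (t, max x₀ r) = ∫ r in x₀..R, h (t, r) := by
  refine intervalIntegral.integral_congr fun r hr => ?_
  rw [uIcc_of_le hR] at hr
  simp only [max_eq_right hr.1]

theorem ContinuousOn.intervalIntegrable_slice {x₀ R : ℝ} (hR : x₀ ≤ R) {h : ℝ × ℝ → ℝ}
    (hh : ContinuousOn h (halfPlane x₀)) (t : ℝ) :
    IntervalIntegrable (fun r => h (t, r)) volume x₀ R := by
  refine ContinuousOn.intervalIntegrable (hh.comp (by fun_prop) fun r hr => ?_)
  rw [uIcc_of_le hR] at hr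
  exact mk_mem_halfPlane _ hr.1

theorem ContinuousOn.continuous_integral_slice {x₀ R : ℝ} (hR : x₀ ≤ R) {h : ℝ × ℝ → ℝ}
    (hh : ContinuousOn h (halfPlane x₀)) : Continuous fun t => ∫ r in x₀..R, h (t, r) := by
  simp_rw [← integral_clamp hR h]
  exact intervalIntegral.continuous_parametric_intervalIntegral_of_continuous'
    (f := fun t r => h (t, max x₀ r)) hh.continuous_clamp x₀ R

theorem integral_slice_mono {x₀ R : ℝ} (hR : x₀ ≤ R) {h k : ℝ × ℝ → ℝ}
    (hh : ContinuousOn h (halfPlane x₀)) (hk : ContinuousOn k (halfPlane x₀)) {t : ℝ}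
    (hle : ∀ r, x₀ < r → h (t, r) ≤ k (t, r)) :
    ∫ r in x₀..R, h (t, r) ≤ ∫ r in x₀..R, k (t, r) :=
  intervalIntegral.integral_mono_on_of_le_Ioo hR (hh.intervalIntegrable_slice hR t)
    (hk.intervalIntegrable_slice hR t) fun r hr => hle r hr.1

theorem lintegral_slice {x₀ R : ℝ} (hR : x₀ ≤ R) {h : ℝ × ℝ → ℝ}
    (hh : ContinuousOn h (halfPlane x₀)) {t : ℝ} (hpos : ∀ r, x₀ < r → 0 ≤ h (t, r))
    (hzero : ∀ r, R ≤ r → h (t, r) = 0) {F : ℝ → ℝ} (hF : ∀ r, x₀ < r → F r = h (t, r)) :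
    ∫⁻ r in Ioi x₀, ENNReal.ofReal (F r) = ENNReal.ofReal (∫ r in x₀..R, h (t, r)) := by
  have hIntg := hh.intervalIntegrable_slice hR t
  have h1 : ∫⁻ r in Ioi x₀, ENNReal.ofReal (F r) = ∫⁻ r in Ioi x₀, ENNReal.ofReal (h (t, r)) :=
    setLIntegral_congr_fun measurableSet_Ioi fun r hr => by rw [hF r hr]
  have h2 : ∫⁻ r in Ioi R, ENNReal.ofReal (h (t, r)) = 0 := by
    rw [setLIntegral_congr_fun (g := fun _ => 0) measurableSet_Ioi
      fun r hr => by simp [hzero r (le_of_lt hr)]]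
    simp
  rw [h1, ← Ioc_union_Ioi_eq_Ioi hR, lintegral_union measurableSet_Ioi (Ioc_disjoint_Ioi le_rfl),
    h2, add_zero, intervalIntegral.integral_of_le hR]
  refine (ofReal_integral_eq_lintegral_ofReal hIntg.1 ?_).symm
  exact (ae_restrict_iff' measurableSet_Ioc).2 (ae_of_all _ fun r hr => hpos r hr.1)

theorem lintegral_lintegral_slice {x₀ R τ : ℝ} (hR : x₀ ≤ R) (hτ : 0 ≤ τ) {h : ℝ × ℝ → ℝ}
    (hh : ContinuousOn h (halfPlane x₀)) (hpos : ∀ t r, x₀ < r → 0 ≤ h (t, r))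
    (hzero : ∀ t ∈ Icc 0 τ, ∀ r, R ≤ r → h (t, r) = 0) {F : ℝ → ℝ → ℝ}
    (hF : ∀ t r, x₀ < r → F t r = h (t, r)) :
    ∫⁻ t in Ioc 0 τ, ∫⁻ r in Ioi x₀, ENNReal.ofReal (F t r) =
      ENNReal.ofReal (∫ t in 0..τ, ∫ r in x₀..R, h (t, r)) := by
  have hIntg : IntervalIntegrable (fun t => ∫ r in x₀..R, h (t, r)) volume 0 τ :=
    (hh.continuous_integral_slice hR).intervalIntegrable _ _
  rw [setLIntegral_congr_fun measurableSet_Ioc fun t ht => lintegral_slice hR hh (hpos t)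
      (hzero t (Ioc_subset_Icc_self ht)) (hF t), intervalIntegral.integral_of_le hτ]
  refine (ofReal_integral_eq_lintegral_ofReal hIntg.1 (ae_of_all _ fun t => ?_)).symm
  exact intervalIntegral.integral_nonneg_of_ae_restrict hR
    ((ae_restrict_iff' measurableSet_Icc).2 <| by
      filter_upwards [Measure.ae_ne volume x₀] with r hr hr'
      exact hpos t r (lt_of_le_of_ne hr'.1 hr.symm))

/-- The energy inequality obtained by integrating `∂ₜ e ≤ ∂ᵣ g + b` over a rectangle, when the
flux `g` vanishes at the outer boundary and is nonnegative at the inner one. -/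
theorem energy_inequality {x₀ R τ : ℝ} (hR : x₀ ≤ R) (hτ : 0 ≤ τ) {e g b : ℝ × ℝ → ℝ}
    (he : ContDiffOn ℝ 1 e (halfPlane x₀)) (hg : ContDiffOn ℝ 1 g (halfPlane x₀))
    (hb : ContinuousOn b (halfPlane x₀))
    (hdiv : ∀ t r, x₀ < r →
      deriv (fun t' => e (t', r)) t ≤ deriv (fun r' => g (t, r')) r + b (t, r))
    (hout : ∀ t ∈ Icc 0 τ, g (t, R) = 0) (hin : ∀ t, 0 ≤ g (t, x₀)) :
    ∫ r in x₀..R, e (τ, r) ≤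
      (∫ r in x₀..R, e (0, r)) + ∫ t in 0..τ, ∫ r in x₀..R, b (t, r) := by
  have hsub : uIcc 0 τ ×ˢ uIcc x₀ R ⊆ halfPlane x₀ := fun p hp => by
    rw [uIcc_of_le hR] at hp
    exact ⟨mem_univ _, hp.2.1⟩
  have hfd : ∀ {k : ℝ × ℝ → ℝ}, ContDiffOn ℝ 1 k (halfPlane x₀) → ∀ t r, x₀ < r →
      HasFDerivAt k (fderivWithin ℝ k (halfPlane x₀) (t, r)) (t, r) := fun hk t r hr =>
    ((hk.differentiableOn one_ne_zero (t, r)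
      (mk_mem_halfPlane t hr.le)).hasFDerivWithinAt).hasFDerivAt (halfPlane_mem_nhds hr)
  have hcont : ∀ {k : ℝ × ℝ → ℝ} (v : ℝ × ℝ), ContDiffOn ℝ 1 k (halfPlane x₀) →
      ContinuousOn (fun p => fderivWithin ℝ k (halfPlane x₀) p v) (halfPlane x₀) := fun v hk =>
    (hk.continuousOn_fderivWithin (uniqueDiffOn_halfPlane x₀) le_rfl).clm_apply continuousOn_const
  have hdivc := (hcont (1, 0) he).add (hcont (0, 1) hg).neg
  have hIntg : IntegrableOn (fun p => fderivWithin ℝ e (halfPlane x₀) p (1, 0) +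
      (-fderivWithin ℝ g (halfPlane x₀) p) (0, 1)) (uIcc 0 τ ×ˢ uIcc x₀ R) :=
    (hdivc.mono hsub).integrableOn_compact (isCompact_uIcc.prod isCompact_uIcc)
  have hmem : ∀ p ∈ Ioo (min 0 τ) (max 0 τ) ×ˢ Ioo (min x₀ R) (max x₀ R) \ (∅ : Set (ℝ × ℝ)),
      x₀ < p.2 := fun p hp => by
    have := hp.1.2.1
    rwa [min_eq_left hR] at this
  have key := integral2_divergence_prod_of_hasFDerivAt_off_countable e (fun p => -g p)
    (fderivWithin ℝ e (halfPlane x₀)) (fun p => -fderivWithin ℝ g (halfPlane x₀) p) 0 x₀ τ R ∅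
    countable_empty (he.continuousOn.mono hsub) (hg.continuousOn.mono hsub).neg
    (fun p hp => hfd he p.1 p.2 (hmem p hp)) (fun p hp => (hfd hg p.1 p.2 (hmem p hp)).neg) hIntg
  have hle : ∫ t in 0..τ, ∫ r in x₀..R, (fderivWithin ℝ e (halfPlane x₀) (t, r) (1, 0) +
      (-fderivWithin ℝ g (halfPlane x₀) (t, r)) (0, 1)) ≤
        ∫ t in 0..τ, ∫ r in x₀..R, b (t, r) := by
    refine intervalIntegral.integral_mono_on hτ
      ((hdivc.continuous_integral_slice hR).intervalIntegrable _ _)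
      ((hb.continuous_integral_slice hR).intervalIntegrable _ _) fun t _ =>
      integral_slice_mono hR hdivc hb fun r hr => ?_
    have h1 : HasDerivAt (fun t' => e (t', r)) _ t := (hfd he t r hr).comp_hasDerivAt t
      ((hasDerivAt_id t).prodMk (hasDerivAt_const t r))
    have h2 : HasDerivAt (fun r' => g (t, r')) _ r := (hfd hg t r hr).comp_hasDerivAt r
      ((hasDerivAt_const r t).prodMk (hasDerivAt_id r))
    have := hdiv t r hr
    rw [h1.deriv, h2.deriv] at this
    simp only [Pi.add_apply, Pi.neg_apply]
    linarith
  have hgR : ∫ t in 0..τ, -g (t, R) = 0 := by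
    rw [intervalIntegral.integral_congr (g := fun _ => 0)]
    · simp
    · intro t ht
      rw [uIcc_of_le hτ] at ht
      simp [hout t ht]
  have hg0 : ∫ t in 0..τ, -g (t, x₀) ≤ 0 := by
    rw [intervalIntegral.integral_neg, neg_nonpos]
    exact intervalIntegral.integral_nonneg hτ fun t _ => hin t
  linarith

/-- The `t`-derivative on the closed half-plane, one-sided at the boundary. -/
def tDer (x₀ : ℝ) (ψ : ℝ → ℝ → ℝ) (p : ℝ × ℝ) : ℝ :=
  fderivWithin ℝ (Function.uncurry ψ) (halfPlane x₀) p (1, 0)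

/-- The `r`-derivative on the closed half-plane, one-sided at the boundary. -/
def rDer (x₀ : ℝ) (ψ : ℝ → ℝ → ℝ) (p : ℝ × ℝ) : ℝ :=
  fderivWithin ℝ (Function.uncurry ψ) (halfPlane x₀) p (0, 1)

section Derivatives

variable {x₀ : ℝ} {ψ : ℝ → ℝ → ℝ}

theorem SmoothOnRegion.contDiffOn_uncurry (h : SmoothOnRegion ψ (Ici x₀)) :
    ContDiffOn ℝ 2 (Function.uncurry ψ) (halfPlane x₀) :=
  ContDiffOn.of_le h (WithTop.coe_le_coe.2 (le_top : (2 : ℕ∞) ≤ ⊤))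

theorem SmoothOnRegion.contDiffOn_tDer (h : SmoothOnRegion ψ (Ici x₀)) :
    ContDiffOn ℝ 1 (tDer x₀ ψ) (halfPlane x₀) :=
  (h.contDiffOn_uncurry.fderivWithin (uniqueDiffOn_halfPlane x₀)
    (by norm_num [one_add_one_eq_two])).clm_apply contDiffOn_const

theorem SmoothOnRegion.contDiffOn_rDer (h : SmoothOnRegion ψ (Ici x₀)) :
    ContDiffOn ℝ 1 (rDer x₀ ψ) (halfPlane x₀) :=
  (h.contDiffOn_uncurry.fderivWithin (uniqueDiffOn_halfPlane x₀)
    (by norm_num [one_add_one_eq_two])).clm_apply contDiffOn_const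

theorem ContDiffOn.hasDerivAt_fst {h : ℝ × ℝ → ℝ} (hh : ContDiffOn ℝ 1 h (halfPlane x₀))
    {t r : ℝ} (hr : x₀ < r) :
    HasDerivAt (fun t' => h (t', r)) (fderiv ℝ h (t, r) (1, 0)) t :=
  ((hh.contDiffAt (halfPlane_mem_nhds hr)).differentiableAt one_ne_zero).hasFDerivAt.comp_hasDerivAt
    t ((hasDerivAt_id t).prodMk (hasDerivAt_const t r))

theorem ContDiffOn.hasDerivAt_snd {h : ℝ × ℝ → ℝ} (hh : ContDiffOn ℝ 1 h (halfPlane x₀))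
    {t r : ℝ} (hr : x₀ < r) :
    HasDerivAt (fun r' => h (t, r')) (fderiv ℝ h (t, r) (0, 1)) r :=
  ((hh.contDiffAt (halfPlane_mem_nhds hr)).differentiableAt one_ne_zero).hasFDerivAt.comp_hasDerivAt
    r ((hasDerivAt_const r t).prodMk (hasDerivAt_id r))

theorem SmoothOnRegion.hasDerivAt_tDer (h : SmoothOnRegion ψ (Ici x₀)) {t r : ℝ} (hr : x₀ < r) :
    HasDerivAt (fun t' => ψ t' r) (tDer x₀ ψ (t, r)) t := by
  have := (h.contDiffOn_uncurry.of_le one_le_two).hasDerivAt_fst (t := t) hr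
  rwa [← fderivWithin_of_mem_nhds (halfPlane_mem_nhds hr)] at this

theorem SmoothOnRegion.hasDerivAt_rDer (h : SmoothOnRegion ψ (Ici x₀)) {t r : ℝ} (hr : x₀ < r) :
    HasDerivAt (fun r' => ψ t r') (rDer x₀ ψ (t, r)) r := by
  have := (h.contDiffOn_uncurry.of_le one_le_two).hasDerivAt_snd (t := t) hr
  rwa [← fderivWithin_of_mem_nhds (halfPlane_mem_nhds hr)] at this

theorem SmoothOnRegion.pt_eq (h : SmoothOnRegion ψ (Ici x₀)) {t r : ℝ} (hr : x₀ < r) :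
    pt ψ t r = tDer x₀ ψ (t, r) :=
  (h.hasDerivAt_tDer hr).deriv

theorem SmoothOnRegion.pr_eq (h : SmoothOnRegion ψ (Ici x₀)) {t r : ℝ} (hr : x₀ < r) :
    pr ψ t r = rDer x₀ ψ (t, r) :=
  (h.hasDerivAt_rDer hr).deriv

theorem SmoothOnRegion.fderiv_tDer_eq_fderiv_rDer (h : SmoothOnRegion ψ (Ici x₀)) {t r : ℝ}
    (hr : x₀ < r) :
    fderiv ℝ (tDer x₀ ψ) (t, r) (0, 1) = fderiv ℝ (rDer x₀ ψ) (t, r) (1, 0) := by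
  have hca : ContDiffAt ℝ 2 (Function.uncurry ψ) (t, r) :=
    h.contDiffOn_uncurry.contDiffAt (halfPlane_mem_nhds hr)
  have hd : DifferentiableAt ℝ (fderiv ℝ (Function.uncurry ψ)) (t, r) :=
    (hca.fderiv_right (m := 1) (by norm_num [one_add_one_eq_two])).differentiableAt one_ne_zero
  have hev : ∀ v : ℝ × ℝ,
      (fun p => fderivWithin ℝ (Function.uncurry ψ) (halfPlane x₀) p v) =ᶠ[nhds (t, r)]
        fun p => fderiv ℝ (Function.uncurry ψ) p v := fun v => by
    filter_upwards [eventually_mem_nhds_iff.2 (halfPlane_mem_nhds (t := t) hr)] with p hp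
    rw [fderivWithin_of_mem_nhds hp]
  have hval : ∀ v w : ℝ × ℝ,
      fderiv ℝ (fun p => fderivWithin ℝ (Function.uncurry ψ) (halfPlane x₀) p v) (t, r) w =
        fderiv ℝ (fderiv ℝ (Function.uncurry ψ)) (t, r) w v := fun v w => by
    rw [(hev v).fderiv_eq, fderiv_clm_apply hd (differentiableAt_const v)]
    simp
  have hsymm := hca.isSymmSndFDerivAt (by simp)
  exact (hval _ _).trans ((hsymm _ _).trans (hval _ _).symm)

/-- The perturbed Regge–Wheeler operator in terms of the derivatives on the half-plane. -/
theorem SmoothOnRegion.Pc_eq {M : ℝ} (hM : 0 < M) (s ℓ : ℕ) (h : SmoothOnRegion ψ (Ici (2 * M)))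
    {t r : ℝ} (hr : 2 * M < r) :
    Pc M s ℓ ψ t r =
      (1 + 2 * M / r) * fderiv ℝ (tDer (2 * M) ψ) (t, r) (1, 0)
        - (4 * M / r) * fderiv ℝ (rDer (2 * M) ψ) (t, r) (1, 0)
        + (2 * M / r ^ 2) * tDer (2 * M) ψ (t, r)
        - ((2 * M / r ^ 2) * rDer (2 * M) ψ (t, r)
          + Dc M r * fderiv ℝ (rDer (2 * M) ψ) (t, r) (0, 1))
        + ((ℓ : ℝ) * (ℓ + 1) / r ^ 2) * ψ t r + (1 - (s : ℝ) ^ 2) * (2 * M / r ^ 3) * ψ t r := by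
  have hr0 : r ≠ 0 := by linarith
  have htt : pt (pt ψ) t r = fderiv ℝ (tDer (2 * M) ψ) (t, r) (1, 0) := by
    simp only [pt, ← (h.contDiffOn_tDer.hasDerivAt_fst hr).deriv]
    exact congrArg (fun k => deriv k t) (funext fun t' => h.pt_eq hr)
  have htr : pt (pr ψ) t r = fderiv ℝ (rDer (2 * M) ψ) (t, r) (1, 0) := by
    simp only [pt, ← (h.contDiffOn_rDer.hasDerivAt_fst hr).deriv]
    exact congrArg (fun k => deriv k t) (funext fun t' => h.pr_eq hr)
  have hD : HasDerivAt (fun r' => Dc M r') (2 * M / r ^ 2) r := by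
    exact (((hasDerivAt_const r (2 * M)).div (hasDerivAt_id r) hr0).const_sub 1).congr_deriv
      (by simp; ring)
  have hrr : pr (fun t' r' => Dc M r' * pr ψ t' r') t r =
      (2 * M / r ^ 2) * rDer (2 * M) ψ (t, r)
        + Dc M r * fderiv ℝ (rDer (2 * M) ψ) (t, r) (0, 1) := by
    have hev : (fun r' => Dc M r' * pr ψ t r') =ᶠ[nhds r]
        fun r' => Dc M r' * rDer (2 * M) ψ (t, r') := by
      filter_upwards [Ioi_mem_nhds hr] with r' hr'
      rw [h.pr_eq hr']
    exact hev.deriv_eq.trans (hD.mul (h.contDiffOn_rDer.hasDerivAt_snd hr)).deriv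
  rw [Pc, htt, htr, hrr, h.pt_eq hr]

theorem exists_vanishing_radius (h : SmoothOnRegion ψ (Ici x₀)) (hc : CompactRSupport ψ) (τ : ℝ) :
    ∃ R, x₀ < R ∧ ∀ t ∈ Icc 0 τ, ∀ r, R ≤ r →
      ψ t r = 0 ∧ tDer x₀ ψ (t, r) = 0 ∧ rDer x₀ ψ (t, r) = 0 := by
  obtain ⟨R, hR⟩ := hc (-1) (τ + 1)
  refine ⟨max R x₀ + 1, by linarith [le_max_right R x₀], fun t ht r hr => ?_⟩
  have h1 : R < r := by linarith [le_max_left R x₀]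
  have h2 : x₀ < r := by linarith [le_max_right R x₀]
  have h0 : ∀ t' ∈ Ioo (-1) (τ + 1), ∀ r', R < r' → ψ t' r' = 0 :=
    fun t' ht' r' hr' => hR t' r' (Ioo_subset_Icc_self ht') hr'.le
  have htI : t ∈ Ioo (-1) (τ + 1) := ⟨by linarith [ht.1], by linarith [ht.2]⟩
  refine ⟨h0 t htI r h1, ?_, ?_⟩
  · have hev : (fun t' => ψ t' r) =ᶠ[nhds t] fun _ => 0 := by
      filter_upwards [isOpen_Ioo.mem_nhds htI] with t' ht' using h0 t' ht' r h1
    rw [← h.pt_eq h2, pt, hev.deriv_eq, deriv_const]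
  · have hev : (fun r' => ψ t r') =ᶠ[nhds r] fun _ => 0 := by
      filter_upwards [Ioi_mem_nhds h1] with r' hr' using h0 t htI r' hr'
    rw [← h.pr_eq h2, pr, hev.deriv_eq, deriv_const]

end Derivatives

/-- The Regge–Wheeler potential. -/
def pot (M : ℝ) (s ℓ : ℕ) (r : ℝ) : ℝ :=
  (ℓ : ℝ) * (ℓ + 1) / r ^ 2 + (1 - (s : ℝ) ^ 2) * (2 * M / r ^ 3)

/-- The energy density of the Killing field `T`. -/
def killingDensity (M : ℝ) (s ℓ : ℕ) (ψ : ℝ → ℝ → ℝ) (p : ℝ × ℝ) : ℝ :=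
  ((1 + 2 * M / p.2) * tDer (2 * M) ψ p ^ 2 + Dc M p.2 * rDer (2 * M) ψ p ^ 2
    + pot M s ℓ p.2 * ψ p.1 p.2 ^ 2) / 2

/-- The radial flux of the Killing field `T`. -/
def killingFlux (M : ℝ) (ψ : ℝ → ℝ → ℝ) (p : ℝ × ℝ) : ℝ :=
  Dc M p.2 * (rDer (2 * M) ψ p * tDer (2 * M) ψ p) + 2 * M / p.2 * tDer (2 * M) ψ p ^ 2

/-- The energy density of the red-shift field `∂ₜ - ∂ᵣ`. -/
def redshiftDensity (M : ℝ) (s ℓ : ℕ) (ψ : ℝ → ℝ → ℝ) (p : ℝ × ℝ) : ℝ :=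
  ((1 + 2 * M / p.2) * (tDer (2 * M) ψ p - rDer (2 * M) ψ p) ^ 2
    + pot M s ℓ p.2 * ψ p.1 p.2 ^ 2) / 2

/-- The radial flux of the red-shift field `∂ₜ - ∂ᵣ`. -/
def redshiftFlux (M : ℝ) (s ℓ : ℕ) (ψ : ℝ → ℝ → ℝ) (p : ℝ × ℝ) : ℝ :=
  (pot M s ℓ p.2 * ψ p.1 p.2 ^ 2
    - Dc M p.2 * (tDer (2 * M) ψ p - rDer (2 * M) ψ p) ^ 2) / 2

/-- The nondegenerate energy density. -/
def energyDensity (M : ℝ) (ℓ : ℕ) (ψ : ℝ → ℝ → ℝ) (p : ℝ × ℝ) : ℝ :=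
  tDer (2 * M) ψ p ^ 2 + rDer (2 * M) ψ p ^ 2
    + (ℓ : ℝ) * (ℓ + 1) * ψ p.1 p.2 ^ 2 / p.2 ^ 2 + ψ p.1 p.2 ^ 2 / p.2 ^ 2

/-- The density of the nondegenerate spacetime energy. -/
def bulkDensity (M : ℝ) (ℓ : ℕ) (ψ : ℝ → ℝ → ℝ) (p : ℝ × ℝ) : ℝ :=
  tDer (2 * M) ψ p ^ 2 / p.2 ^ 2 + rDer (2 * M) ψ p ^ 2 / p.2 ^ 2
    + (ℓ : ℝ) * (ℓ + 1) * ψ p.1 p.2 ^ 2 / p.2 ^ 3 + ψ p.1 p.2 ^ 2 / p.2 ^ 3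

section Potential

variable {M r : ℝ} {s ℓ : ℕ}

theorem Dc_nonneg (hM : 0 < M) (hr : 2 * M ≤ r) : 0 ≤ Dc M r := by
  have hr0 : 0 < r := by linarith
  rw [Dc, sub_nonneg, div_le_one hr0]
  exact hr

theorem Dc_le_one (hM : 0 < M) (hr : 2 * M ≤ r) : Dc M r ≤ 1 := by
  have hr0 : 0 < r := by linarith
  have : 0 ≤ 2 * M / r := by positivity
  rw [Dc]
  linarith

theorem hasDerivAt_const_div (hr : r ≠ 0) (m : ℝ) :
    HasDerivAt (fun x => m / x) (-(m / r ^ 2)) r :=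
  ((hasDerivAt_const r m).div (hasDerivAt_id r) hr).congr_deriv (by simp; ring)

theorem hasDerivAt_Dc (hr : r ≠ 0) : HasDerivAt (fun x => Dc M x) (2 * M / r ^ 2) r :=
  ((hasDerivAt_const_div hr (2 * M)).const_sub 1).congr_deriv (neg_neg _)

theorem hasDerivAt_pot (hr : r ≠ 0) :
    HasDerivAt (fun x => pot M s ℓ x)
      (-(3 * pot M s ℓ r / r) + (ℓ : ℝ) * (ℓ + 1) / r ^ 3) r := by
  have h2 := ((hasDerivAt_const r ((ℓ : ℝ) * (ℓ + 1))).div (hasDerivAt_pow 2 r) (pow_ne_zero 2 hr))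
  have h3 := ((hasDerivAt_const r (2 * M)).div (hasDerivAt_pow 3 r) (pow_ne_zero 3 hr)).const_mul
    (1 - (s : ℝ) ^ 2)
  refine (h2.add h3).congr_deriv ?_
  simp only [pot]
  field_simp
  ring

/-- Twice the potential bounds the angular term from above. -/
theorem angular_le_pot (hM : 0 < M) (hr : 2 * M ≤ r) (hs : s ≤ 2) (hℓ : s ≤ ℓ) :
    (ℓ : ℝ) * (ℓ + 1) / r ^ 2 ≤ 2 * pot M s ℓ r := by
  have hr0 : 0 < r := by linarith
  have hMr : 2 * M / r ^ 3 ≤ 1 / r ^ 2 := by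
    rw [div_le_div_iff₀ (by positivity) (by positivity)]
    nlinarith [mul_le_mul_of_nonneg_right hr (sq_nonneg r)]
  have hMr' : 0 ≤ 2 * M / r ^ 3 := by positivity
  have hL : 0 ≤ (ℓ : ℝ) * (ℓ + 1) / r ^ 2 := by positivity
  unfold pot
  interval_cases s
  · norm_num; linarith
  · norm_num; linarith
  · have h2 : (2 : ℝ) ≤ ℓ := by exact_mod_cast hℓ
    have h6 : 6 * (1 / r ^ 2) ≤ (ℓ : ℝ) * (ℓ + 1) / r ^ 2 := by
      rw [mul_one_div]
      exact div_le_div_of_nonneg_right (by nlinarith) (by positivity)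
    norm_num
    norm_num at h6 hMr
    linarith

theorem pot_nonneg (hM : 0 < M) (hr : 2 * M ≤ r) (hs : s ≤ 2) (hℓ : s ≤ ℓ) :
    0 ≤ pot M s ℓ r := by
  have hr0 : 0 < r := by linarith
  have hL : 0 ≤ (ℓ : ℝ) * (ℓ + 1) / r ^ 2 := by positivity
  linarith [angular_le_pot hM hr hs hℓ]

theorem pot_le (hM : 0 < M) (hr : 2 * M ≤ r) :
    pot M s ℓ r ≤ (ℓ : ℝ) * (ℓ + 1) / r ^ 2 + 1 / r ^ 2 := by
  have hr0 : 0 < r := by linarith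
  have hMr : 2 * M / r ^ 3 ≤ 1 / r ^ 2 := by
    rw [div_le_div_iff₀ (by positivity) (by positivity)]
    nlinarith [mul_le_mul_of_nonneg_right hr (sq_nonneg r)]
  have hMr' : 0 ≤ 2 * M / r ^ 3 := by positivity
  unfold pot
  nlinarith [sq_nonneg (s : ℝ), mul_nonneg (sq_nonneg (s : ℝ)) hMr']

end Potential

section Regularity

variable {M : ℝ} {ψ : ℝ → ℝ → ℝ}

theorem contDiffOn_const_div_snd (hM : 0 < M) (m : ℝ) (n : ℕ) :
    ContDiffOn ℝ 1 (fun p : ℝ × ℝ => m / p.2 ^ n) (halfPlane (2 * M)) :=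
  contDiffOn_const.div (contDiffOn_snd.pow n) fun p hp => pow_ne_zero n (by
    have : 2 * M ≤ p.2 := hp.2
    linarith)

theorem contDiffOn_Dc (hM : 0 < M) :
    ContDiffOn ℝ 1 (fun p : ℝ × ℝ => Dc M p.2) (halfPlane (2 * M)) := by
  simpa only [Dc, pow_one] using contDiffOn_const.sub (contDiffOn_const_div_snd hM (2 * M) 1)

theorem contDiffOn_pot (hM : 0 < M) (s ℓ : ℕ) :
    ContDiffOn ℝ 1 (fun p : ℝ × ℝ => pot M s ℓ p.2) (halfPlane (2 * M)) :=
  (contDiffOn_const_div_snd hM _ 2).add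
    (contDiffOn_const.mul (contDiffOn_const_div_snd hM (2 * M) 3))

theorem contDiffOn_killingDensity (hM : 0 < M) (s ℓ : ℕ)
    (h : SmoothOnRegion ψ (Ici (2 * M))) :
    ContDiffOn ℝ 1 (killingDensity M s ℓ ψ) (halfPlane (2 * M)) := by
  have hμ := contDiffOn_const_div_snd hM (2 * M) 1
  simp only [pow_one] at hμ
  exact ((((contDiffOn_const.add hμ).mul (h.contDiffOn_tDer.pow 2)).add
    ((contDiffOn_Dc hM).mul (h.contDiffOn_rDer.pow 2))).add
    ((contDiffOn_pot hM s ℓ).mul ((h.contDiffOn_uncurry.of_le one_le_two).pow 2))).div_const 2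

theorem contDiffOn_killingFlux (hM : 0 < M) (h : SmoothOnRegion ψ (Ici (2 * M))) :
    ContDiffOn ℝ 1 (killingFlux M ψ) (halfPlane (2 * M)) := by
  have hμ := contDiffOn_const_div_snd hM (2 * M) 1
  simp only [pow_one] at hμ
  exact ((contDiffOn_Dc hM).mul (h.contDiffOn_rDer.mul h.contDiffOn_tDer)).add
    (hμ.mul (h.contDiffOn_tDer.pow 2))

theorem contDiffOn_redshiftDensity (hM : 0 < M) (s ℓ : ℕ)
    (h : SmoothOnRegion ψ (Ici (2 * M))) :
    ContDiffOn ℝ 1 (redshiftDensity M s ℓ ψ) (halfPlane (2 * M)) := by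
  have hμ := contDiffOn_const_div_snd hM (2 * M) 1
  simp only [pow_one] at hμ
  exact (((contDiffOn_const.add hμ).mul ((h.contDiffOn_tDer.sub h.contDiffOn_rDer).pow 2)).add
    ((contDiffOn_pot hM s ℓ).mul ((h.contDiffOn_uncurry.of_le one_le_two).pow 2))).div_const 2

theorem contDiffOn_redshiftFlux (hM : 0 < M) (s ℓ : ℕ) (h : SmoothOnRegion ψ (Ici (2 * M))) :
    ContDiffOn ℝ 1 (redshiftFlux M s ℓ ψ) (halfPlane (2 * M)) :=
  (((contDiffOn_pot hM s ℓ).mul ((h.contDiffOn_uncurry.of_le one_le_two).pow 2)).sub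
    ((contDiffOn_Dc hM).mul ((h.contDiffOn_tDer.sub h.contDiffOn_rDer).pow 2))).div_const 2

theorem continuousOn_div_snd_pow (hM : 0 < M) {h : ℝ × ℝ → ℝ}
    (hh : ContinuousOn h (halfPlane (2 * M))) (n : ℕ) :
    ContinuousOn (fun p => h p / p.2 ^ n) (halfPlane (2 * M)) :=
  hh.div (continuousOn_snd.pow n) fun p hp => pow_ne_zero n (by
    have : 2 * M ≤ p.2 := hp.2
    linarith)

theorem continuousOn_energyDensity (hM : 0 < M) (ℓ : ℕ) (h : SmoothOnRegion ψ (Ici (2 * M))) :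
    ContinuousOn (energyDensity M ℓ ψ) (halfPlane (2 * M)) := by
  have hu : ContinuousOn (fun p : ℝ × ℝ => ψ p.1 p.2 ^ 2) (halfPlane (2 * M)) :=
    h.contDiffOn_uncurry.continuousOn.pow 2
  exact (((h.contDiffOn_tDer.continuousOn.pow 2).add (h.contDiffOn_rDer.continuousOn.pow 2)).add
    (continuousOn_div_snd_pow hM (continuousOn_const.mul hu) 2)).add
    (continuousOn_div_snd_pow hM hu 2)

theorem continuousOn_bulkDensity (hM : 0 < M) (ℓ : ℕ) (h : SmoothOnRegion ψ (Ici (2 * M))) :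
    ContinuousOn (bulkDensity M ℓ ψ) (halfPlane (2 * M)) := by
  have hu : ContinuousOn (fun p : ℝ × ℝ => ψ p.1 p.2 ^ 2) (halfPlane (2 * M)) :=
    h.contDiffOn_uncurry.continuousOn.pow 2
  exact (((continuousOn_div_snd_pow hM (h.contDiffOn_tDer.continuousOn.pow 2) 2).add
    (continuousOn_div_snd_pow hM (h.contDiffOn_rDer.continuousOn.pow 2) 2)).add
    (continuousOn_div_snd_pow hM (continuousOn_const.mul hu) 3)).add
    (continuousOn_div_snd_pow hM hu 3)

end Regularity

section Identities

variable {M : ℝ} {ψ : ℝ → ℝ → ℝ}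

theorem deriv_killingDensity (hM : 0 < M) (s ℓ : ℕ) (h : SmoothOnRegion ψ (Ici (2 * M)))
    {t r : ℝ} (hr : 2 * M < r) :
    deriv (fun t' => killingDensity M s ℓ ψ (t', r)) t =
      deriv (fun r' => killingFlux M ψ (t, r')) r
        + Pc M s ℓ ψ t r * tDer (2 * M) ψ (t, r) := by
  have hr0 : r ≠ 0 := by linarith
  have hut := h.hasDerivAt_tDer (t := t) hr
  have hat := h.contDiffOn_tDer.hasDerivAt_fst (t := t) hr
  have hct := h.contDiffOn_rDer.hasDerivAt_fst (t := t) hr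
  have har := h.contDiffOn_tDer.hasDerivAt_snd (t := t) hr
  have hcr := h.contDiffOn_rDer.hasDerivAt_snd (t := t) hr
  have he := ((((hat.pow 2).const_mul (1 + 2 * M / r)).add
    ((hct.pow 2).const_mul (Dc M r))).add ((hut.pow 2).const_mul (pot M s ℓ r))).div_const 2
  have hg := ((hasDerivAt_Dc (M := M) hr0).mul (hcr.mul har)).add
    ((hasDerivAt_const_div hr0 (2 * M)).mul (har.pow 2))
  refine he.deriv.trans (Eq.trans ?_ (congrArg (· + _) hg.deriv.symm))
  rw [h.Pc_eq hM s ℓ hr, h.fderiv_tDer_eq_fderiv_rDer hr]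
  simp only [pot, Pi.mul_apply, Pi.pow_apply]
  push_cast
  ring

theorem deriv_redshiftDensity (hM : 0 < M) (s ℓ : ℕ) (h : SmoothOnRegion ψ (Ici (2 * M)))
    {t r : ℝ} (hr : 2 * M < r) :
    deriv (fun t' => redshiftDensity M s ℓ ψ (t', r)) t =
      deriv (fun r' => redshiftFlux M s ℓ ψ (t, r')) r
        + Pc M s ℓ ψ t r * (tDer (2 * M) ψ (t, r) - rDer (2 * M) ψ (t, r))
        - M / r ^ 2 * (tDer (2 * M) ψ (t, r) - rDer (2 * M) ψ (t, r)) ^ 2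
        + (3 * pot M s ℓ r / r - (ℓ : ℝ) * (ℓ + 1) / r ^ 3) * ψ t r ^ 2 / 2 := by
  have hr0 : r ≠ 0 := by linarith
  have hut := h.hasDerivAt_tDer (t := t) hr
  have hur := h.hasDerivAt_rDer (t := t) hr
  have hat := h.contDiffOn_tDer.hasDerivAt_fst (t := t) hr
  have hct := h.contDiffOn_rDer.hasDerivAt_fst (t := t) hr
  have har := h.contDiffOn_tDer.hasDerivAt_snd (t := t) hr
  have hcr := h.contDiffOn_rDer.hasDerivAt_snd (t := t) hr
  have he := ((((hat.sub hct).pow 2).const_mul (1 + 2 * M / r)).add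
    ((hut.pow 2).const_mul (pot M s ℓ r))).div_const 2
  have hg := (((hasDerivAt_pot (M := M) (s := s) (ℓ := ℓ) hr0).mul (hur.pow 2)).sub
    ((hasDerivAt_Dc (M := M) hr0).mul ((har.sub hcr).pow 2))).div_const 2
  refine he.deriv.trans (Eq.trans ?_ (congrArg (· + _ - _ + _) hg.deriv.symm))
  rw [h.Pc_eq hM s ℓ hr, h.fderiv_tDer_eq_fderiv_rDer hr]
  simp only [pot, Dc, Pi.sub_apply, Pi.pow_apply]
  push_cast
  ring

theorem abs_Pc_le {C ε : ℝ} {s ℓ : ℕ} {βt βr : ℝ → ℝ → ℝ} (hM : 0 < M) (hε : 0 ≤ ε)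
    (hβ : BetaBounds M C βt βr) (h : SmoothOnRegion ψ (Ici (2 * M)))
    (hsol : SolvesPerturbedRW M s ℓ ε βt βr ψ) {t r : ℝ} (hr : 2 * M < r) :
    |Pc M s ℓ ψ t r| ≤
      ε * C / r ^ 2 * (|tDer (2 * M) ψ (t, r)| + |rDer (2 * M) ψ (t, r)|) := by
  have hr0 : 0 < r := by linarith
  have hW : 0 ≤ r ^ ((3 : ℝ) / 2) * |Wc M βt t r| + r ^ ((3 : ℝ) / 2) * |Wc M βr t r| := by
    positivity
  have hb := hβ t r hr
  have hbt : |βt t r| ≤ C / r ^ 2 := by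
    rw [le_div_iff₀ (by positivity)]
    nlinarith [mul_nonneg (sq_nonneg r) (abs_nonneg (βr t r))]
  have hbr : |βr t r| ≤ C / r ^ 2 := by
    rw [le_div_iff₀ (by positivity)]
    nlinarith [mul_nonneg (sq_nonneg r) (abs_nonneg (βt t r))]
  rw [hsol t r hr, h.pt_eq hr, h.pr_eq hr, abs_mul, abs_of_nonneg hε, mul_div_assoc, mul_assoc]
  refine mul_le_mul_of_nonneg_left ((abs_add_le _ _).trans ?_) hε
  rw [abs_mul, abs_mul, mul_add]
  gcongr

theorem forcing_le_bulkDensity {C ε F a c r : ℝ} (hC : 0 ≤ C) (hε : 0 ≤ ε) {x : ℝ}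
    (hF : |F| ≤ ε * C / r ^ 2 * (|a| + |c|)) (hx : |x| ≤ |a| + |c|) :
    F * x ≤ 2 * ε * C * (a ^ 2 / r ^ 2 + c ^ 2 / r ^ 2) := by
  have hk : 0 ≤ ε * C / r ^ 2 := by positivity
  calc F * x ≤ |F| * |x| := (le_abs_self _).trans_eq (abs_mul _ _)
    _ ≤ ε * C / r ^ 2 * (|a| + |c|) * (|a| + |c|) :=
        mul_le_mul hF hx (abs_nonneg _) (by positivity)
    _ ≤ ε * C / r ^ 2 * (2 * (|a| ^ 2 + |c| ^ 2)) := by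
        rw [mul_assoc]
        exact mul_le_mul_of_nonneg_left (by nlinarith [sq_nonneg (|a| - |c|)]) hk
    _ = 2 * ε * C * (a ^ 2 / r ^ 2 + c ^ 2 / r ^ 2) := by
        rw [sq_abs, sq_abs]
        ring

theorem derivatives_le_bulkDensity (hM : 0 < M) (ℓ : ℕ) {t r : ℝ} (hr : 2 * M < r) :
    tDer (2 * M) ψ (t, r) ^ 2 / r ^ 2 + rDer (2 * M) ψ (t, r) ^ 2 / r ^ 2 ≤
      bulkDensity M ℓ ψ (t, r) := by
  have hr0 : 0 < r := by linarith
  have : 0 ≤ (ℓ : ℝ) * (ℓ + 1) * ψ t r ^ 2 / r ^ 3 + ψ t r ^ 2 / r ^ 3 := by positivity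
  simp only [bulkDensity]
  linarith

theorem bulkDensity_nonneg (hM : 0 < M) (ℓ : ℕ) {t r : ℝ} (hr : 2 * M < r) :
    0 ≤ bulkDensity M ℓ ψ (t, r) :=
  le_trans (by positivity) (derivatives_le_bulkDensity hM ℓ hr)

theorem energyDensity_nonneg (M : ℝ) (ψ : ℝ → ℝ → ℝ) (ℓ : ℕ) (p : ℝ × ℝ) :
    0 ≤ energyDensity M ℓ ψ p := by
  unfold energyDensity
  positivity

theorem deriv_killingDensity_le {C ε : ℝ} {s ℓ : ℕ} {βt βr : ℝ → ℝ → ℝ} (hM : 0 < M)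
    (hC : 0 ≤ C) (hε : 0 ≤ ε) (hβ : BetaBounds M C βt βr) (h : SmoothOnRegion ψ (Ici (2 * M)))
    (hsol : SolvesPerturbedRW M s ℓ ε βt βr ψ) {t r : ℝ} (hr : 2 * M < r) :
    deriv (fun t' => killingDensity M s ℓ ψ (t', r)) t ≤
      deriv (fun r' => killingFlux M ψ (t, r')) r + 2 * ε * C * bulkDensity M ℓ ψ (t, r) := by
  rw [deriv_killingDensity hM s ℓ h hr]
  have h1 := forcing_le_bulkDensity hC hε (abs_Pc_le hM hε hβ h hsol hr)
    (x := tDer (2 * M) ψ (t, r)) (le_add_of_nonneg_right (abs_nonneg _))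
  have h2 := mul_le_mul_of_nonneg_left
    (derivatives_le_bulkDensity (ψ := ψ) hM ℓ (t := t) hr) (by positivity : 0 ≤ 2 * ε * C)
  linarith

theorem deriv_redshiftDensity_le {C ε : ℝ} {s ℓ : ℕ} {βt βr : ℝ → ℝ → ℝ} (hM : 0 < M)
    (hC : 0 ≤ C) (hε : 0 ≤ ε) (hs : s ≤ 2) (hℓ : s ≤ ℓ) (hβ : BetaBounds M C βt βr)
    (h : SmoothOnRegion ψ (Ici (2 * M))) (hsol : SolvesPerturbedRW M s ℓ ε βt βr ψ) {t r : ℝ}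
    (hr : 2 * M < r) :
    deriv (fun t' => redshiftDensity M s ℓ ψ (t', r)) t
        + 1 / (16 * M) * redshiftDensity M s ℓ ψ (t, r) ≤
      deriv (fun r' => redshiftFlux M s ℓ ψ (t, r')) r
        + (3 / M * killingDensity M s ℓ ψ (t, r) + 2 * ε * C * bulkDensity M ℓ ψ (t, r)) := by
  rw [deriv_redshiftDensity hM s ℓ h hr]
  have hr0 : 0 < r := by linarith
  have h1 := forcing_le_bulkDensity hC hε (abs_Pc_le hM hε hβ h hsol hr)
    (x := tDer (2 * M) ψ (t, r) - rDer (2 * M) ψ (t, r)) (abs_sub _ _)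
  have h2 := mul_le_mul_of_nonneg_left
    (derivatives_le_bulkDensity (ψ := ψ) hM ℓ (t := t) hr) (by positivity : 0 ≤ 2 * ε * C)
  have hV : 0 ≤ pot M s ℓ r * ψ t r ^ 2 :=
    mul_nonneg (pot_nonneg hM hr.le hs hℓ) (sq_nonneg _)
  have hD := Dc_nonneg hM hr.le
  have hμ0 : 0 ≤ 2 * M / r := by positivity
  have hμ1 : 2 * M / r ≤ 1 := by
    rw [div_le_one hr0]
    exact hr.le
  have hDμ : Dc M r = 1 - 2 * M / r := rfl
  set a := tDer (2 * M) ψ (t, r)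
  set c := rDer (2 * M) ψ (t, r)
  have hpot : (3 * pot M s ℓ r / r - (ℓ : ℝ) * (ℓ + 1) / r ^ 3) * ψ t r ^ 2 / 2 ≤
      3 / (4 * M) * (pot M s ℓ r * ψ t r ^ 2) := by
    have hL : 0 ≤ (ℓ : ℝ) * (ℓ + 1) / r ^ 3 * ψ t r ^ 2 := by positivity
    have h3 : 3 / (2 * r) ≤ 3 / (4 * M) := by
      rw [div_le_div_iff₀ (by positivity) (by positivity)]
      linarith
    have h4 := mul_le_mul_of_nonneg_right h3 hV
    have h5 : 3 / (2 * r) * (pot M s ℓ r * ψ t r ^ 2) = 3 * pot M s ℓ r / r * ψ t r ^ 2 / 2 := by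
      field_simp
    linarith
  have hdamp : 1 / (16 * M) * (a - c) ^ 2 ≤
      M / r ^ 2 * (a - c) ^ 2 + 1 / (4 * M) * (a ^ 2 + Dc M r * c ^ 2) := by
    rcases le_total r (4 * M) with hr4 | hr4
    · have h3 : 1 / (16 * M) ≤ M / r ^ 2 := by
        rw [div_le_div_iff₀ (by positivity) (by positivity)]
        nlinarith
      have h4 := mul_le_mul_of_nonneg_right h3 (sq_nonneg (a - c))
      have h5 : 0 ≤ 1 / (4 * M) * (a ^ 2 + Dc M r * c ^ 2) := by positivity
      linarith
    · have h3 : 1 / 2 ≤ Dc M r := by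
        have : 2 * M / r ≤ 1 / 2 := by
          rw [div_le_div_iff₀ hr0 two_pos]
          linarith
        rw [hDμ]
        linarith
      have h4 : (a - c) ^ 2 ≤ 4 * (a ^ 2 + Dc M r * c ^ 2) := by
        nlinarith [sq_nonneg (a + c), mul_le_mul_of_nonneg_right h3 (sq_nonneg c), sq_nonneg a]
      have h5 := mul_le_mul_of_nonneg_left h4 (by positivity : 0 ≤ 1 / (16 * M))
      have h6 : 1 / (16 * M) * (4 * (a ^ 2 + Dc M r * c ^ 2)) =
          1 / (4 * M) * (a ^ 2 + Dc M r * c ^ 2) := by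
        field_simp
        norm_num
      have h7 : 0 ≤ M / r ^ 2 * (a - c) ^ 2 := by positivity
      linarith
  have hred : redshiftDensity M s ℓ ψ (t, r) ≤ (a - c) ^ 2 + pot M s ℓ r * ψ t r ^ 2 / 2 := by
    simp only [redshiftDensity]
    nlinarith [mul_le_mul_of_nonneg_right hμ1 (sq_nonneg (a - c))]
  have hkill : (a ^ 2 + Dc M r * c ^ 2) / 2 + pot M s ℓ r * ψ t r ^ 2 / 2 ≤
      killingDensity M s ℓ ψ (t, r) := by
    simp only [killingDensity]
    nlinarith [mul_nonneg hμ0 (sq_nonneg a)]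
  have hred' := mul_le_mul_of_nonneg_left hred (by positivity : 0 ≤ 1 / (16 * M))
  have hkill' := mul_le_mul_of_nonneg_left hkill (by positivity : 0 ≤ 3 / M)
  have hMi : 0 ≤ 1 / M := by positivity
  have hX : 0 ≤ 1 / M * (a ^ 2 + Dc M r * c ^ 2) := by positivity
  have hY : 0 ≤ 1 / M * (pot M s ℓ r * ψ t r ^ 2) := by positivity
  have e1 : 1 / (16 * M) = 1 / 16 * (1 / M) := by field_simp
  have e2 : 1 / (4 * M) = 1 / 4 * (1 / M) := by field_simp
  have e3 : 3 / (4 * M) = 3 / 4 * (1 / M) := by field_simp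
  have e4 : 3 / M = 3 * (1 / M) := by field_simp
  rw [e1] at hred' hdamp ⊢
  rw [e2] at hdamp
  rw [e3] at hpot
  rw [e4] at hkill' ⊢
  linarith

end Identities

section Coercivity

variable {M : ℝ} {s ℓ : ℕ}

theorem killingDensity_le_energyDensity (hM : 0 < M) (ψ : ℝ → ℝ → ℝ) {t r : ℝ}
    (hr : 2 * M < r) : killingDensity M s ℓ ψ (t, r) ≤ energyDensity M ℓ ψ (t, r) := by
  have hr0 : 0 < r := by linarith
  have hμ1 : 2 * M / r ≤ 1 := by
    rw [div_le_one hr0]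
    exact hr.le
  have hV := mul_le_mul_of_nonneg_right (pot_le (s := s) (ℓ := ℓ) hM hr.le) (sq_nonneg (ψ t r))
  have hL : 0 ≤ (ℓ : ℝ) * (ℓ + 1) * ψ t r ^ 2 / r ^ 2 + ψ t r ^ 2 / r ^ 2 := by positivity
  have hV' : ((ℓ : ℝ) * (ℓ + 1) / r ^ 2 + 1 / r ^ 2) * ψ t r ^ 2 =
      (ℓ : ℝ) * (ℓ + 1) * ψ t r ^ 2 / r ^ 2 + ψ t r ^ 2 / r ^ 2 := by ring
  simp only [killingDensity, energyDensity]
  nlinarith [mul_le_mul_of_nonneg_right hμ1 (sq_nonneg (tDer (2 * M) ψ (t, r))),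
    mul_le_mul_of_nonneg_right (Dc_le_one hM hr.le) (sq_nonneg (rDer (2 * M) ψ (t, r))),
    sq_nonneg (rDer (2 * M) ψ (t, r))]

theorem redshiftDensity_le_energyDensity (hM : 0 < M) (ψ : ℝ → ℝ → ℝ) {t r : ℝ}
    (hr : 2 * M < r) : redshiftDensity M s ℓ ψ (t, r) ≤ 2 * energyDensity M ℓ ψ (t, r) := by
  have hr0 : 0 < r := by linarith
  have hμ1 : 2 * M / r ≤ 1 := by
    rw [div_le_one hr0]
    exact hr.le
  have hV := mul_le_mul_of_nonneg_right (pot_le (s := s) (ℓ := ℓ) hM hr.le) (sq_nonneg (ψ t r))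
  have hL : 0 ≤ (ℓ : ℝ) * (ℓ + 1) * ψ t r ^ 2 / r ^ 2 + ψ t r ^ 2 / r ^ 2 := by positivity
  have hV' : ((ℓ : ℝ) * (ℓ + 1) / r ^ 2 + 1 / r ^ 2) * ψ t r ^ 2 =
      (ℓ : ℝ) * (ℓ + 1) * ψ t r ^ 2 / r ^ 2 + ψ t r ^ 2 / r ^ 2 := by ring
  simp only [redshiftDensity, energyDensity]
  nlinarith [mul_le_mul_of_nonneg_right hμ1
      (sq_nonneg (tDer (2 * M) ψ (t, r) - rDer (2 * M) ψ (t, r))),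
    sq_nonneg (tDer (2 * M) ψ (t, r) + rDer (2 * M) ψ (t, r))]

theorem energyDensity_le (hM : 0 < M) (hs : s ≤ 2) (hℓ : s ≤ ℓ) (ψ : ℝ → ℝ → ℝ) {t r : ℝ}
    (hr : 2 * M < r) :
    energyDensity M ℓ ψ (t, r) ≤
      10 * killingDensity M s ℓ ψ (t, r) + 4 * redshiftDensity M s ℓ ψ (t, r)
        + ψ t r ^ 2 / r ^ 2 := by
  have hr0 : 0 < r := by linarith
  have hμ0 : 0 ≤ 2 * M / r := by positivity
  have hV := mul_le_mul_of_nonneg_right (angular_le_pot hM hr.le hs hℓ) (sq_nonneg (ψ t r))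
  have hV0 := mul_nonneg (pot_nonneg hM hr.le hs hℓ) (sq_nonneg (ψ t r))
  have hV' : (ℓ : ℝ) * (ℓ + 1) / r ^ 2 * ψ t r ^ 2 = (ℓ : ℝ) * (ℓ + 1) * ψ t r ^ 2 / r ^ 2 := by
    ring
  have hD := mul_nonneg (Dc_nonneg hM hr.le) (sq_nonneg (rDer (2 * M) ψ (t, r)))
  simp only [killingDensity, redshiftDensity, energyDensity]
  nlinarith [mul_nonneg hμ0 (sq_nonneg (tDer (2 * M) ψ (t, r))),
    mul_nonneg hμ0 (sq_nonneg (tDer (2 * M) ψ (t, r) - rDer (2 * M) ψ (t, r))),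
    sq_nonneg (2 * tDer (2 * M) ψ (t, r) - rDer (2 * M) ψ (t, r)),
    sq_nonneg (tDer (2 * M) ψ (t, r))]

/-- A Hardy inequality: the Killing energy controls the zeroth-order term. -/
theorem integral_sq_div_sq_le {ψ : ℝ → ℝ → ℝ} (hM : 0 < M) (hs : s ≤ 2) (hℓ : s ≤ ℓ)
    (h : SmoothOnRegion ψ (Ici (2 * M))) {t R : ℝ} (hR : 2 * M < R) (hψ : ψ t R = 0) :
    ∫ r in (2 * M)..R, ψ t r ^ 2 / r ^ 2 ≤
      16 * ∫ r in (2 * M)..R, killingDensity M s ℓ ψ (t, r) := by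
  have hu : ContinuousOn (fun p : ℝ × ℝ => ψ p.1 p.2) (halfPlane (2 * M)) :=
    h.contDiffOn_uncurry.continuousOn
  have hc := h.contDiffOn_rDer.continuousOn
  have hD := (contDiffOn_Dc hM).continuousOn
  have hkill := (contDiffOn_killingDensity hM s ℓ h).continuousOn
  have hleft : ContinuousOn (fun p : ℝ × ℝ => ψ p.1 p.2 ^ 2 / p.2 ^ 2) (halfPlane (2 * M)) :=
    continuousOn_div_snd_pow hM (hu.pow 2) 2
  let G : ℝ × ℝ → ℝ := fun p => -(Dc M p.2 * ψ p.1 p.2 ^ 2 / p.2 ^ 1)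
  let G' : ℝ × ℝ → ℝ := fun p => -(2 * M * ψ p.1 p.2 ^ 2 / p.2 ^ 3)
    - Dc M p.2 * (2 * ψ p.1 p.2 * rDer (2 * M) ψ p) / p.2 ^ 1
    + Dc M p.2 * ψ p.1 p.2 ^ 2 / p.2 ^ 2
  have hG : ContinuousOn G (halfPlane (2 * M)) :=
    (continuousOn_div_snd_pow hM (hD.mul (hu.pow 2)) 1).neg
  have hG' : ContinuousOn G' (halfPlane (2 * M)) :=
    ((continuousOn_div_snd_pow hM (continuousOn_const.mul (hu.pow 2)) 3).neg.sub
      (continuousOn_div_snd_pow hM (hD.mul ((continuousOn_const.mul hu).mul hc)) 1)).add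
      (continuousOn_div_snd_pow hM (hD.mul (hu.pow 2)) 2)
  have hftc : ∫ r in (2 * M)..R, G' (t, r) = 0 := by
    rw [intervalIntegral.integral_eq_sub_of_hasDerivAt_of_le hR.le (f := fun r => G (t, r))
      (hG.comp (by fun_prop) fun r hr => mk_mem_halfPlane t hr.1) ?_
      (hG'.intervalIntegrable_slice hR.le t)]
    · have h0 : Dc M (2 * M) = 0 := by
        rw [Dc, div_self (by positivity), sub_self]
      simp [G, hψ, h0]
    · intro r hr
      have hr0 : r ≠ 0 := by linarith [hr.1]
      refine (((hasDerivAt_Dc hr0).mul ((h.hasDerivAt_rDer hr.1).pow 2)).div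
        (hasDerivAt_pow 1 r) (pow_ne_zero 1 hr0)).neg.congr_deriv ?_
      simp only [G', Pi.mul_apply, Pi.pow_apply]
      field_simp
      push_cast
      ring
  have hle : ∫ r in (2 * M)..R, ψ t r ^ 2 / r ^ 2 ≤
      ∫ r in (2 * M)..R, (16 * killingDensity M s ℓ ψ (t, r) + 2 * G' (t, r)) := by
    by_cases hs0 : s = 0
    · subst hs0
      refine integral_slice_mono hR.le hleft
        ((continuousOn_const.mul hkill).add (continuousOn_const.mul hG')) fun r hr => ?_
      have hr0 : 0 < r := by linarith
      have hD0 := Dc_nonneg hM hr.le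
      have hD1 := Dc_le_one hM hr.le
      have hμ : Dc M r = 1 - 2 * M / r := rfl
      have hpos : 0 ≤ 2 * M * ψ t r ^ 2 / r ^ 3 := by positivity
      have hL : 0 ≤ (ℓ : ℝ) * (ℓ + 1) / r ^ 2 * ψ t r ^ 2 := by positivity
      have hμa : 0 ≤ 2 * M / r * tDer (2 * M) ψ (t, r) ^ 2 := by positivity
      have hpot : pot M 0 ℓ r * ψ t r ^ 2 =
          (ℓ : ℝ) * (ℓ + 1) / r ^ 2 * ψ t r ^ 2 + 2 * M * ψ t r ^ 2 / r ^ 3 := by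
        simp only [pot]
        push_cast
        ring
      have hDψ : Dc M r * ψ t r ^ 2 / r ^ 2 = ψ t r ^ 2 / r ^ 2 - 2 * M * ψ t r ^ 2 / r ^ 3 := by
        rw [hμ]
        field_simp
      have hx : ψ t r ^ 2 / r ^ 2 = (ψ t r / r) ^ 2 := by ring
      have hxy : Dc M r * (2 * ψ t r * rDer (2 * M) ψ (t, r)) / r ^ 1 =
          2 * (Dc M r * (ψ t r / r * rDer (2 * M) ψ (t, r))) := by ring
      change ψ t r ^ 2 / r ^ 2 ≤ 16 * killingDensity M 0 ℓ ψ (t, r) + 2 * G' (t, r)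
      simp only [killingDensity, G']
      rw [hpot, hDψ, hxy, hx]
      nlinarith [mul_nonneg hD0 (sq_nonneg (ψ t r / r - 2 * rDer (2 * M) ψ (t, r))),
        mul_le_mul_of_nonneg_right hD1 (sq_nonneg (ψ t r / r)),
        mul_nonneg hD0 (sq_nonneg (rDer (2 * M) ψ (t, r))),
        sq_nonneg (tDer (2 * M) ψ (t, r))]
    · have hle' : ∫ r in (2 * M)..R, ψ t r ^ 2 / r ^ 2 ≤
          ∫ r in (2 * M)..R, 16 * killingDensity M s ℓ ψ (t, r) := by
        refine integral_slice_mono hR.le hleft (continuousOn_const.mul hkill) fun r hr => ?_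
        have hr0 : 0 < r := by linarith
        have hℓ1 : (1 : ℝ) ≤ ℓ := by exact_mod_cast (by omega : 1 ≤ ℓ)
        have h1 : 1 / r ^ 2 ≤ (ℓ : ℝ) * (ℓ + 1) / r ^ 2 :=
          div_le_div_of_nonneg_right (by nlinarith) (by positivity)
        have h2 := mul_le_mul_of_nonneg_right (h1.trans (angular_le_pot hM hr.le hs hℓ))
          (sq_nonneg (ψ t r))
        have h3 : 1 / r ^ 2 * ψ t r ^ 2 = ψ t r ^ 2 / r ^ 2 := by ring
        have h4 := mul_nonneg (pot_nonneg hM hr.le hs hℓ) (sq_nonneg (ψ t r))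
        have h5 := mul_nonneg (Dc_nonneg hM hr.le) (sq_nonneg (rDer (2 * M) ψ (t, r)))
        have h6 : 0 ≤ (1 + 2 * M / r) * tDer (2 * M) ψ (t, r) ^ 2 := by positivity
        change ψ t r ^ 2 / r ^ 2 ≤ 16 * killingDensity M s ℓ ψ (t, r)
        simp only [killingDensity]
        linarith
      rw [intervalIntegral.integral_add
        ((hkill.intervalIntegrable_slice hR.le t).const_mul 16)
        ((hG'.intervalIntegrable_slice hR.le t).const_mul 2),
        intervalIntegral.integral_const_mul 2, hftc, mul_zero, add_zero]
      exact hle'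
  rwa [intervalIntegral.integral_add
    ((hkill.intervalIntegrable_slice hR.le t).const_mul 16)
    ((hG'.intervalIntegrable_slice hR.le t).const_mul 2),
    intervalIntegral.integral_const_mul, intervalIntegral.integral_const_mul, hftc, mul_zero,
    add_zero] at hle

theorem integral_energyDensity_le {ψ : ℝ → ℝ → ℝ} (hM : 0 < M) (hs : s ≤ 2) (hℓ : s ≤ ℓ)
    (h : SmoothOnRegion ψ (Ici (2 * M))) {t R : ℝ} (hR : 2 * M < R) (hψ : ψ t R = 0) :
    ∫ r in (2 * M)..R, energyDensity M ℓ ψ (t, r) ≤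
      26 * (∫ r in (2 * M)..R, killingDensity M s ℓ ψ (t, r))
        + 4 * ∫ r in (2 * M)..R, redshiftDensity M s ℓ ψ (t, r) := by
  have hu : ContinuousOn (fun p : ℝ × ℝ => ψ p.1 p.2) (halfPlane (2 * M)) :=
    h.contDiffOn_uncurry.continuousOn
  have hk := (contDiffOn_killingDensity hM s ℓ h).continuousOn
  have hr := (contDiffOn_redshiftDensity hM s ℓ h).continuousOn
  have hz : ContinuousOn (fun p : ℝ × ℝ => ψ p.1 p.2 ^ 2 / p.2 ^ 2) (halfPlane (2 * M)) :=
    continuousOn_div_snd_pow hM (hu.pow 2) 2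
  have hle := integral_slice_mono hR.le (continuousOn_energyDensity hM ℓ h)
    (((continuousOn_const (c := (10 : ℝ)).mul hk).add
      (continuousOn_const (c := (4 : ℝ)).mul hr)).add hz) (t := t)
    fun r hr => energyDensity_le hM hs hℓ ψ hr
  have hk' := (hk.intervalIntegrable_slice hR.le t).const_mul 10
  have hr' := (hr.intervalIntegrable_slice hR.le t).const_mul 4
  have hsum : ∫ r in (2 * M)..R, (10 * killingDensity M s ℓ ψ (t, r)
      + 4 * redshiftDensity M s ℓ ψ (t, r) + ψ t r ^ 2 / r ^ 2) =
      10 * (∫ r in (2 * M)..R, killingDensity M s ℓ ψ (t, r))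
        + 4 * (∫ r in (2 * M)..R, redshiftDensity M s ℓ ψ (t, r))
        + ∫ r in (2 * M)..R, ψ t r ^ 2 / r ^ 2 := by
    rw [intervalIntegral.integral_add (hk'.add hr') (hz.intervalIntegrable_slice hR.le t),
      intervalIntegral.integral_add hk' hr', intervalIntegral.integral_const_mul,
      intervalIntegral.integral_const_mul]
  linarith [hle.trans_eq hsum, integral_sq_div_sq_le hM hs hℓ h hR hψ]

end Coercivity

section Boundedness

variable {M C ε : ℝ} {s ℓ : ℕ} {βt βr ψ : ℝ → ℝ → ℝ}

theorem integral_killingDensity_le (hM : 0 < M) (hC : 0 ≤ C) (hε : 0 ≤ ε)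
    (hβ : BetaBounds M C βt βr) (h : SmoothOnRegion ψ (Ici (2 * M)))
    (hsol : SolvesPerturbedRW M s ℓ ε βt βr ψ) {R τ : ℝ} (hR : 2 * M < R) (hτ : 0 ≤ τ)
    (hzero : ∀ t ∈ Icc 0 τ, tDer (2 * M) ψ (t, R) = 0) :
    ∫ r in (2 * M)..R, killingDensity M s ℓ ψ (τ, r) ≤
      (∫ r in (2 * M)..R, energyDensity M ℓ ψ (0, r))
        + 2 * ε * C * ∫ t in 0..τ, ∫ r in (2 * M)..R, bulkDensity M ℓ ψ (t, r) := by
  have hk := contDiffOn_killingDensity hM s ℓ h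
  have key := energy_inequality hR.le hτ hk (contDiffOn_killingFlux hM h)
    (continuousOn_const.mul (continuousOn_bulkDensity hM ℓ h))
    (fun t r hr => deriv_killingDensity_le hM hC hε hβ h hsol hr)
    (fun t ht => by simp [killingFlux, hzero t ht]) fun t => by
      have h0 : Dc M (2 * M) = 0 := by
        rw [Dc, div_self (by positivity), sub_self]
      simp only [killingFlux, h0]
      rw [zero_mul, zero_add]
      positivity
  simp only [Pi.mul_apply, intervalIntegral.integral_const_mul] at key
  exact key.trans (add_le_add_left (integral_slice_mono hR.le hk.continuousOn
    (continuousOn_energyDensity hM ℓ h) fun r hr => killingDensity_le_energyDensity hM ψ hr) _)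

theorem integral_exp_le {b τ : ℝ} (hb : 0 < b) :
    ∫ t in 0..τ, Real.exp (b * (t - τ)) ≤ 1 / b := by
  have hd : ∀ t ∈ uIcc 0 τ,
      HasDerivAt (fun t => Real.exp (b * (t - τ)) / b) (Real.exp (b * (t - τ))) t := fun t _ =>
    ((((hasDerivAt_id t).sub_const τ).const_mul b).exp.div_const b).congr_deriv (by
      simp only [id]
      field_simp)
  rw [intervalIntegral.integral_eq_sub_of_hasDerivAt hd
    (Continuous.intervalIntegrable (by fun_prop) _ _), sub_self, mul_zero, Real.exp_zero]
  have : 0 < Real.exp (b * (0 - τ)) / b := by positivity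
  linarith

theorem integral_redshiftDensity_le (hM : 0 < M) (hC : 0 ≤ C) (hε : 0 ≤ ε) (hs : s ≤ 2)
    (hℓ : s ≤ ℓ) (hβ : BetaBounds M C βt βr) (h : SmoothOnRegion ψ (Ici (2 * M)))
    (hsol : SolvesPerturbedRW M s ℓ ε βt βr ψ) {R τ X : ℝ} (hR : 2 * M < R) (hτ : 0 ≤ τ)
    (hzero : ∀ t ∈ Icc 0 τ,
      ψ t R = 0 ∧ tDer (2 * M) ψ (t, R) = 0 ∧ rDer (2 * M) ψ (t, R) = 0)
    (hX0 : 0 ≤ X)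
    (hX : ∀ t ∈ Icc 0 τ, ∫ r in (2 * M)..R, killingDensity M s ℓ ψ (t, r) ≤ X) :
    ∫ r in (2 * M)..R, redshiftDensity M s ℓ ψ (τ, r) ≤
      2 * (∫ r in (2 * M)..R, energyDensity M ℓ ψ (0, r)) + 48 * X
        + 2 * ε * C * ∫ t in 0..τ, ∫ r in (2 * M)..R, bulkDensity M ℓ ψ (t, r) := by
  let w : ℝ → ℝ := fun t => Real.exp (1 / (16 * M) * (t - τ))
  have hwpos : ∀ t, 0 < w t := fun t => Real.exp_pos _
  have hwτ : w τ = 1 := by simp [w]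
  have hw1 : ∀ t ≤ τ, w t ≤ 1 := fun t ht => Real.exp_le_one_iff.2
    (mul_nonpos_of_nonneg_of_nonpos (by positivity) (sub_nonpos.2 ht))
  have hwc : Continuous w := by fun_prop
  have hwd : ∀ t, HasDerivAt w (1 / (16 * M) * w t) t := fun t =>
    (((hasDerivAt_id t).sub_const τ).const_mul (1 / (16 * M))).exp.congr_deriv (by
      simp only [id, w]
      ring)
  have hw : ContDiffOn ℝ 1 (fun p : ℝ × ℝ => w p.1) (halfPlane (2 * M)) := by
    apply ContDiff.contDiffOn
    fun_prop
  have hk := (contDiffOn_killingDensity hM s ℓ h).continuousOn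
  have hr := contDiffOn_redshiftDensity hM s ℓ h
  have hf := contDiffOn_redshiftFlux hM s ℓ h
  have hbulk := continuousOn_bulkDensity hM ℓ h
  have hV : 0 ≤ pot M s ℓ (2 * M) := pot_nonneg hM le_rfl hs hℓ
  have key := energy_inequality (e := fun p => w p.1 * redshiftDensity M s ℓ ψ p)
    (g := fun p => w p.1 * redshiftFlux M s ℓ ψ p)
    (b := fun p => w p.1 * (3 / M * killingDensity M s ℓ ψ p
      + 2 * ε * C * bulkDensity M ℓ ψ p)) hR.le hτ (hw.mul hr) (hw.mul hf)
    (hw.continuousOn.mul ((continuousOn_const.mul hk).add (continuousOn_const.mul hbulk)))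
    (fun t r hr' => by
      have hle := mul_le_mul_of_nonneg_left
        (deriv_redshiftDensity_le hM hC hε hs hℓ hβ h hsol (t := t) hr') (hwpos t).le
      have h1 := (hwd t).mul (hr.hasDerivAt_fst (t := t) hr')
      have h2 := (hf.hasDerivAt_snd (t := t) hr').const_mul (w t)
      rw [(hr.hasDerivAt_fst (t := t) hr').deriv, (hf.hasDerivAt_snd (t := t) hr').deriv] at hle
      refine h1.deriv.trans_le (le_trans ?_ (add_le_add_left h2.deriv.ge _))
      linarith)
    (fun t ht => by
      obtain ⟨h1, h2, h3⟩ := hzero t ht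
      simp [redshiftFlux, h1, h2, h3])
    (fun t => by
      have h0 : Dc M (2 * M) = 0 := by
        rw [Dc, div_self (by positivity), sub_self]
      have := hwpos t
      simp only [redshiftFlux, h0]
      rw [zero_mul, sub_zero]
      positivity)
  simp only [intervalIntegral.integral_const_mul, hwτ, one_mul] at key
  have hKnn : 0 ≤ 2 * ε * C := by positivity
  have hinit : w 0 * ∫ r in (2 * M)..R, redshiftDensity M s ℓ ψ (0, r) ≤
      2 * ∫ r in (2 * M)..R, energyDensity M ℓ ψ (0, r) := by
    have h1 := integral_slice_mono hR.le hr.continuousOn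
      (continuousOn_const.mul (continuousOn_energyDensity hM ℓ h)) (t := 0)
      fun r hr => redshiftDensity_le_energyDensity (s := s) (ℓ := ℓ) hM ψ hr
    simp only [Pi.mul_apply, intervalIntegral.integral_const_mul] at h1
    have h2 : 0 ≤ ∫ r in (2 * M)..R, energyDensity M ℓ ψ (0, r) :=
      intervalIntegral.integral_nonneg hR.le fun r _ => energyDensity_nonneg M ψ ℓ _
    have h3 := mul_le_mul_of_nonneg_left h1 (hwpos 0).le
    have h4 := mul_le_mul_of_nonneg_right (hw1 0 hτ)
      (by positivity : 0 ≤ 2 * ∫ r in (2 * M)..R, energyDensity M ℓ ψ (0, r))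
    linarith
  have hkc := hk.continuous_integral_slice hR.le
  have hbc := hbulk.continuous_integral_slice hR.le
  have hsource : ∫ t in 0..τ, w t * ∫ r in (2 * M)..R, (3 / M * killingDensity M s ℓ ψ (t, r)
      + 2 * ε * C * bulkDensity M ℓ ψ (t, r)) ≤
      48 * X + 2 * ε * C * ∫ t in 0..τ, ∫ r in (2 * M)..R, bulkDensity M ℓ ψ (t, r) := by
    have hsplit : ∀ t, ∫ r in (2 * M)..R, (3 / M * killingDensity M s ℓ ψ (t, r)
        + 2 * ε * C * bulkDensity M ℓ ψ (t, r)) =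
        3 / M * (∫ r in (2 * M)..R, killingDensity M s ℓ ψ (t, r))
          + 2 * ε * C * ∫ r in (2 * M)..R, bulkDensity M ℓ ψ (t, r) := fun t => by
      rw [intervalIntegral.integral_add ((hk.intervalIntegrable_slice hR.le t).const_mul _)
        ((hbulk.intervalIntegrable_slice hR.le t).const_mul _),
        intervalIntegral.integral_const_mul, intervalIntegral.integral_const_mul]
    simp only [hsplit]
    have hmono : ∫ t in 0..τ, w t * (3 / M * (∫ r in (2 * M)..R, killingDensity M s ℓ ψ (t, r))
          + 2 * ε * C * ∫ r in (2 * M)..R, bulkDensity M ℓ ψ (t, r)) ≤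
        ∫ t in 0..τ, (3 / M * X * w t
          + 2 * ε * C * ∫ r in (2 * M)..R, bulkDensity M ℓ ψ (t, r)) := by
      refine intervalIntegral.integral_mono_on hτ
        (Continuous.intervalIntegrable (by fun_prop) _ _)
        (Continuous.intervalIntegrable (by fun_prop) _ _) fun t ht => ?_
      have hb0 : 0 ≤ ∫ r in (2 * M)..R, bulkDensity M ℓ ψ (t, r) := by
        have := integral_slice_mono hR.le (continuousOn_const (c := (0 : ℝ))) hbulk (t := t)
          fun r hr => bulkDensity_nonneg hM ℓ hr
        simpa using this
      have h1 := mul_le_mul_of_nonneg_left (hX t ht)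
        (by have := hwpos t; positivity : 0 ≤ w t * (3 / M))
      have h2 := mul_le_mul_of_nonneg_right (hw1 t ht.2) (mul_nonneg hKnn hb0)
      linarith
    rw [intervalIntegral.integral_add (Continuous.intervalIntegrable (by fun_prop) _ _)
      (Continuous.intervalIntegrable (by fun_prop) _ _), intervalIntegral.integral_const_mul,
      intervalIntegral.integral_const_mul] at hmono
    have hexp := mul_le_mul_of_nonneg_left
      (integral_exp_le (τ := τ) (by positivity : 0 < 1 / (16 * M)))
      (by positivity : 0 ≤ 3 / M * X)
    have h48 : 3 / M * X * (1 / (1 / (16 * M))) = 48 * X := by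
      field_simp
      ring
    linarith
  linarith

theorem integral_energyDensity_bounded (hM : 0 < M) (hC : 0 ≤ C) (hε : 0 ≤ ε) (hs : s ≤ 2)
    (hℓ : s ≤ ℓ) (hβ : BetaBounds M C βt βr) (h : SmoothOnRegion ψ (Ici (2 * M)))
    (hsol : SolvesPerturbedRW M s ℓ ε βt βr ψ) {R τ : ℝ} (hR : 2 * M < R) (hτ : 0 ≤ τ)
    (hzero : ∀ t ∈ Icc 0 τ,
      ψ t R = 0 ∧ tDer (2 * M) ψ (t, R) = 0 ∧ rDer (2 * M) ψ (t, R) = 0) :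
    ∫ r in (2 * M)..R, energyDensity M ℓ ψ (τ, r) ≤
      226 * (1 + 2 * C) * ((∫ r in (2 * M)..R, energyDensity M ℓ ψ (0, r))
        + ε * ∫ t in 0..τ, ∫ r in (2 * M)..R, bulkDensity M ℓ ψ (t, r)) := by
  have hbulk := continuousOn_bulkDensity hM ℓ h
  have hbc := hbulk.continuous_integral_slice hR.le
  have hb0 : ∀ t, 0 ≤ ∫ r in (2 * M)..R, bulkDensity M ℓ ψ (t, r) := fun t => by
    have := integral_slice_mono hR.le (continuousOn_const (c := (0 : ℝ))) hbulk (t := t)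
      fun r hr => bulkDensity_nonneg hM ℓ hr
    simpa using this
  have hKnn : 0 ≤ 2 * ε * C := by positivity
  have hE0 : 0 ≤ ∫ r in (2 * M)..R, energyDensity M ℓ ψ (0, r) :=
    intervalIntegral.integral_nonneg hR.le fun r _ => energyDensity_nonneg M ψ ℓ _
  have hI0 : 0 ≤ ∫ t in 0..τ, ∫ r in (2 * M)..R, bulkDensity M ℓ ψ (t, r) :=
    intervalIntegral.integral_nonneg hτ fun t _ => hb0 t
  have hkill : ∀ t ∈ Icc 0 τ, ∫ r in (2 * M)..R, killingDensity M s ℓ ψ (t, r) ≤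
      (∫ r in (2 * M)..R, energyDensity M ℓ ψ (0, r))
        + 2 * ε * C * ∫ t in 0..τ, ∫ r in (2 * M)..R, bulkDensity M ℓ ψ (t, r) := fun t ht => by
    have h1 := integral_killingDensity_le hM hC hε hβ h hsol hR ht.1 fun t' ht' =>
      (hzero t' ⟨ht'.1, ht'.2.trans ht.2⟩).2.1
    have h2 := intervalIntegral.integral_mono_interval (μ := volume) le_rfl ht.1 ht.2
      (Filter.Eventually.of_forall hb0) (hbc.intervalIntegrable 0 τ)
    exact h1.trans (add_le_add_right (mul_le_mul_of_nonneg_left h2 hKnn) _)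
  have hred := integral_redshiftDensity_le hM hC hε hs hℓ hβ h hsol hR hτ hzero
    (add_nonneg hE0 (mul_nonneg hKnn hI0)) hkill
  have hτmem : τ ∈ Icc 0 τ := ⟨hτ, le_rfl⟩
  have hcoer := integral_energyDensity_le hM hs hℓ h hR (hzero τ hτmem).1
  have hk := hkill τ hτmem
  have hεI := mul_nonneg hε hI0
  have hCE := mul_nonneg hC hE0
  have hCεI := mul_nonneg hC hεI
  linarith

end Boundedness

/-- **Eq. (7): mode-reduced energy boundedness estimate.** -/
theorem energy_boundedness (M C : ℝ) (hM : 0 < M) (hC : 0 < C) (s : ℕ) (hs : s ≤ 2) :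
    ∃ Ct : ℝ, 0 < Ct ∧
      ∀ (ℓ : ℕ), s ≤ ℓ →
      ∀ ε : ℝ, 0 ≤ ε → ε ≤ 1 →
      ∀ βt βr ψ : ℝ → ℝ → ℝ,
        SmoothOnRegion βt (Ioi (2*M)) → SmoothOnRegion βr (Ioi (2*M)) →
        BetaBounds M C βt βr →
        SmoothOnRegion ψ (Ici (2*M)) → CompactRSupport ψ →
        SolvesPerturbedRW M s ℓ ε βt βr ψ →
        ∀ τ : ℝ, 0 < τ →
          eEbar M ℓ ψ τ
            ≤ ENNReal.ofReal Ct * (eEbar M ℓ ψ 0 + ENNReal.ofReal ε * iNdegBar M ℓ ψ 0 τ) := by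
  refine ⟨226 * (1 + 2 * C), by positivity, ?_⟩
  intro ℓ hℓ ε hε _ βt βr ψ _ _ hβ h hc hsol τ hτ
  obtain ⟨R, hR, hzero⟩ := exists_vanishing_radius h hc τ
  have hslice : ∀ t ∈ Icc 0 τ, eEbar M ℓ ψ t =
      ENNReal.ofReal (∫ r in (2 * M)..R, energyDensity M ℓ ψ (t, r)) := fun t ht =>
    lintegral_slice hR.le (continuousOn_energyDensity hM ℓ h)
      (fun r _ => energyDensity_nonneg M ψ ℓ _)
      (fun r hr => by
        obtain ⟨h1, h2, h3⟩ := hzero t ht r hr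
        simp [energyDensity, h1, h2, h3])
      fun r hr => by rw [h.pt_eq hr, h.pr_eq hr, energyDensity]
  have hbulk : iNdegBar M ℓ ψ 0 τ =
      ENNReal.ofReal (∫ t in 0..τ, ∫ r in (2 * M)..R, bulkDensity M ℓ ψ (t, r)) :=
    lintegral_lintegral_slice hR.le hτ.le (continuousOn_bulkDensity hM ℓ h)
      (fun t r hr => bulkDensity_nonneg hM ℓ hr)
      (fun t ht r hr => by
        obtain ⟨h1, h2, h3⟩ := hzero t ht r hr
        simp [bulkDensity, h1, h2, h3])
      fun t r hr => by rw [h.pt_eq hr, h.pr_eq hr, bulkDensity]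
  have hmain := integral_energyDensity_bounded hM hC.le hε hs hℓ hβ h hsol hR hτ.le
    fun t ht => hzero t ht R le_rfl
  rw [hslice τ ⟨hτ.le, le_rfl⟩, hslice 0 ⟨le_rfl, hτ.le⟩, hbulk, ← ENNReal.ofReal_mul hε]
  refine (ENNReal.ofReal_le_ofReal hmain).trans ?_
  rw [ENNReal.ofReal_mul (by positivity)]
  gcongr
  exact ENNReal.ofReal_add_le
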